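/- The solution set of the equilibrium problem is closed and convex: let C be a nonempty closed convex subset of E and let g : C × C → ℝ satisfy conditions (A1)–(A4). Then the set EP(g) := {z ∈ C : g(z,y) ≥ 0 for all y ∈ C} is a closed and convex subset of C. -/

import Mathlib

open Filter Topology

/-- Minty's lemma for equilibrium problems: a point `z` solves the equilibrium problem of `g` on `C`
iff it solves the dual problem `g y z ≤ 0` for all `y ∈ C`. -/
theorem forall_nonneg_iff_forall_nonpos_swap
    {E : Type*} [AddCommGroup E] [Module ℝ E] {C : Set E} (hC : Convex ℝ C) {g : E → E → ℝ}
    (hdiag : ∀ x ∈ C, g x x = 0)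
    (hmono : ∀ x ∈ C, ∀ y ∈ C, g x y + g y x ≤ 0)
    (hlimsup : ∀ x ∈ C, ∀ y ∈ C,
      limsup (fun t : ℝ => g (x + t • (y - x)) y) (𝓝[>] (0 : ℝ)) ≤ g x y)
    (hconv : ∀ x ∈ C, ConvexOn ℝ C (g x)) {z : E} (hz : z ∈ C) :
    (∀ y ∈ C, 0 ≤ g z y) ↔ ∀ y ∈ C, g y z ≤ 0 := by
  refine ⟨fun h y hy => by linarith [h y hy, hmono z hz y hy], fun h y hy => ?_⟩
  have hsegment : ∀ t ∈ Set.Ioo (0 : ℝ) 1, 0 ≤ g (z + t • (y - z)) y := by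
    rintro t ⟨ht0, ht1⟩
    have hx : z + t • (y - z) ∈ C := hC.add_smul_sub_mem hz hy ⟨ht0.le, ht1.le⟩
    have hle := (hconv _ hx).2 hz hy (sub_nonneg.2 ht1.le) ht0.le (sub_add_cancel 1 t)
    rw [show (1 - t) • z + t • y = z + t • (y - z) by module, hdiag _ hx, smul_eq_mul,
      smul_eq_mul] at hle
    have hz' := mul_nonpos_of_nonneg_of_nonpos (sub_nonneg.2 ht1.le) (h _ hx)
    exact nonneg_of_mul_nonneg_right (by linarith) ht0
  refine le_trans ?_ (hlimsup z hz y hy)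
  -- If the function is unbounded above near `0`, the real `limsup` is `sInf ∅ = 0`.
  rw [limsup_eq]
  refine Real.sInf_nonneg fun a ha => ?_
  rw [Set.mem_ofPred_eq] at ha
  obtain ⟨t, hta, ht⟩ := (ha.and (Ioo_mem_nhdsGT one_pos)).exists
  exact (hsegment t ht).trans hta

/-- The solution set of the equilibrium problem is closed and convex: let `C` be a
nonempty closed convex subset of a reflexive space `E` and let `g : C × C → ℝ`
satisfy (A1)–(A4).  Then `EP(g) := {z ∈ C : g(z,y) ≥ 0 for all y ∈ C}` is a closed
and convex subset of `C`. -/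
theorem EP_closed_convex
    {E : Type*} [NormedAddCommGroup E] [NormedSpace ℝ E] [CompleteSpace E]
    (hrefl : Function.Surjective (NormedSpace.inclusionInDoubleDual ℝ E))
    (C : Set E) (hCne : C.Nonempty) (hCclosed : IsClosed C) (hCconv : Convex ℝ C)
    (g : E → E → ℝ)
    (hA1 : ∀ x ∈ C, g x x = 0)
    (hA2 : ∀ x ∈ C, ∀ y ∈ C, g x y + g y x ≤ 0)
    (hA3 : ∀ x ∈ C, ∀ z ∈ C, ∀ y ∈ C,
      limsup (fun t : ℝ => g (x + t • (z - x)) y) (𝓝[>] (0:ℝ)) ≤ g x y)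
    (hA4 : ∀ x ∈ C, ConvexOn ℝ C (g x) ∧ LowerSemicontinuousOn (g x) C) :
    IsClosed {z : E | z ∈ C ∧ ∀ y ∈ C, 0 ≤ g z y} ∧
      Convex ℝ {z : E | z ∈ C ∧ ∀ y ∈ C, 0 ≤ g z y} ∧
      {z : E | z ∈ C ∧ ∀ y ∈ C, 0 ≤ g z y} ⊆ C := by
  have heq : {z : E | z ∈ C ∧ ∀ y ∈ C, 0 ≤ g z y} = C ∩ ⋂ y ∈ C, {z ∈ C | g y z ≤ 0} := by
    ext z
    simp only [Set.mem_ofPred_eq, Set.mem_inter_iff, Set.mem_iInter]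
    refine and_congr_right fun hz => ?_
    rw [forall_nonneg_iff_forall_nonpos_swap hCconv hA1 hA2 (fun x hx y hy => hA3 x hx y hy y hy)
      (fun x hx => (hA4 x hx).1) hz]
    simp [hz]
  refine ⟨?_, ?_, fun z hz => hz.1⟩
  · rw [heq]
    refine hCclosed.inter (isClosed_biInter fun y hy => ?_)
    obtain ⟨v, hv, hCv⟩ := lowerSemicontinuousOn_iff_preimage_Iic.1 (hA4 y hy).2 0
    exact (hCv ▸ hCclosed.inter hv : IsClosed (C ∩ g y ⁻¹' Set.Iic 0))
  · rw [heq]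
    exact hCconv.inter (convex_iInter₂ fun y hy => (hA4 y hy).1.convex_le 0)
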